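/- arXiv:2104.11988 — 2 statements merged into one kernel-verified Lean document; each statement's English description precedes it below -/
import Mathlib

section
/- Let n ≥ 1, 0 < α < 1, and let S ∈ C^{1,α}(∂Δ, ℂ^{n×n}) be such that S(ζ) is symmetric and the operator norm ‖S(ζ)‖ < 1 for every ζ ∈ ∂Δ. If φ ∈ O^{1,α}(∂Δ, ℂⁿ) satisfies φ(1) = 0, φ'(1) = 0, and the map ∂Δ ∋ ζ ↦ conj(φ(ζ)/ζ) + S(ζ)·(φ(ζ)/ζ) belongs to O^{1,α}(∂Δ, ℂⁿ), then φ ≡ 0. -/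
open Set Metric

noncomputable section

/-- The open unit disc `Δ ⊂ ℂ`. -/
def uDisc : Set ℂ := Metric.ball 0 1
/-- The closed unit disc `Δ̄ ⊂ ℂ`. -/
def cDisc : Set ℂ := Metric.closedBall 0 1
/-- The unit circle `∂Δ ⊂ ℂ`. -/
def uCircle : Set ℂ := Metric.sphere 0 1

/-- `f` is of class `C^{k,β}` on `s`: continuous derivatives up to order `k` on `s`,
with `β`-Hölder `k`-th derivative. -/
def CkHolderOn {E F : Type*} [NormedAddCommGroup E] [NormedSpace ℝ E]
    [NormedAddCommGroup F] [NormedSpace ℝ F] (k : ℕ) (β : ℝ) (f : E → F) (s : Set E) : Prop :=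
  ContDiffOn ℝ k f s ∧
    ∃ C : NNReal, HolderOnWith C β.toNNReal (iteratedFDerivWithin ℝ k f s) s

/-- `f ∈ C^{k,β}(∂Δ, F)`: the `2π`-periodic parametrization `θ ↦ f(e^{iθ})` has continuous
derivatives up to order `k`, the `k`-th one being `β`-Hölder. -/
def CircleCk {F : Type*} [NormedAddCommGroup F] [NormedSpace ℝ F]
    (k : ℕ) (β : ℝ) (f : ℂ → F) : Prop :=
  CkHolderOn k β (fun θ : ℝ => f (Complex.exp ((θ : ℂ) * Complex.I))) univ

/-- `g ∈ O^{k,β}(∂Δ, F)`: `g` is holomorphic on `Δ` and of class `C^{k,β}` up to the boundary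
(`g` is identified with the extension to `Δ̄` of its boundary values). -/
def OHolder {F : Type*} [NormedAddCommGroup F] [NormedSpace ℂ F]
    (k : ℕ) (β : ℝ) (g : ℂ → F) : Prop :=
  DifferentiableOn ℂ g uDisc ∧ ContinuousOn g cDisc ∧ CkHolderOn k β g cDisc
/-- Componentwise complex conjugation on `ℂⁿ`. -/
def conjVecE {n : ℕ} (v : EuclideanSpace ℂ (Fin n)) : EuclideanSpace ℂ (Fin n) :=
  (EuclideanSpace.equiv (Fin n) ℂ).symm (fun j => (starRingEnd ℂ) (v j))


lemma DiffContOnCl.continuousOn_unit_sphere {E : Type*} [NormedAddCommGroup E] [NormedSpace ℂ E]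
    {f : ℂ → E} (hf : DiffContOnCl ℂ f (ball 0 1)) : ContinuousOn f (sphere 0 1) := by
  refine hf.continuousOn.mono ?_
  rw [closure_ball _ one_ne_zero]
  exact sphere_subset_closedBall

lemma mul_conj_of_mem_unit_sphere {z : ℂ} (hz : z ∈ sphere (0 : ℂ) 1) :
    z * (starRingEnd ℂ) z = 1 := by
  rw [Complex.mul_conj, Complex.normSq_eq_norm_sq, mem_sphere_zero_iff_norm.1 hz]
  simp

lemma one_sub_mul_ne_zero_of_norm_le_one {r : ℝ} (hr : 0 ≤ r) (hr1 : r < 1) {z : ℂ} (hz : ‖z‖ ≤ 1) :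
    1 - (r : ℂ) * z ≠ 0 := by
  intro h
  have h2 : ‖(r : ℂ) * z‖ = 1 := by rw [← sub_eq_zero.1 h]; simp
  rw [norm_mul, Complex.norm_real, Real.norm_of_nonneg hr] at h2
  nlinarith

lemma sub_ofReal_ne_zero_of_mem_unit_sphere {r : ℝ} (hr : 0 ≤ r) (hr1 : r < 1) {z : ℂ}
    (hz : z ∈ sphere (0 : ℂ) 1) : z - r ≠ 0 := by
  intro h
  have h2 := mem_sphere_zero_iff_norm.1 hz
  rw [sub_eq_zero.1 h, Complex.norm_real, Real.norm_of_nonneg hr] at h2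
  linarith

lemma diffContOnCl_inv_one_sub_mul {r : ℝ} (hr : 0 ≤ r) (hr1 : r < 1) :
    DiffContOnCl ℂ (fun z : ℂ => (1 - (r : ℂ) * z)⁻¹) (ball 0 1) := by
  refine DiffContOnCl.inv (Differentiable.diffContOnCl (by fun_prop)) fun z hz => ?_
  rw [closure_ball _ one_ne_zero] at hz
  exact one_sub_mul_ne_zero_of_norm_le_one hr hr1 (mem_closedBall_zero_iff.1 hz)

lemma DiffContOnCl.circleAverage_unit_smul_div {f : ℂ → ℂ} (hf : DiffContOnCl ℂ f (ball 0 1))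
    {r : ℝ} (hr : 0 ≤ r) (hr1 : r < 1) :
    Real.circleAverage (fun z => z / (z - r) * f z) 0 1 = f r := by
  have := DiffContOnCl.circleAverage_smul_div (f := f) (c := 0) (R := 1) (w := r) (by simpa using hf)
    (by simp [abs_of_nonneg hr, hr1])
  simpa using this

lemma DiffContOnCl.circleAverage_div_norm_sq {f : ℂ → ℂ} (hf : DiffContOnCl ℂ f (ball 0 1))
    {r : ℝ} (hr : 0 ≤ r) (hr1 : r < 1) :
    Real.circleAverage (fun z => f z / ((‖1 - (r : ℂ) * z‖ ^ 2 : ℝ) : ℂ)) 0 1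
      = f r / (1 - (r : ℂ) ^ 2) := by
  have h := ((diffContOnCl_inv_one_sub_mul hr hr1).smul hf).circleAverage_unit_smul_div hr hr1
  simp only [smul_eq_mul] at h
  rw [show f r / (1 - (r : ℂ) ^ 2) = (1 - (r : ℂ) * r)⁻¹ * f r by ring, ← h]
  refine Real.circleAverage_congr_sphere fun z hz => ?_
  rw [abs_one] at hz
  have h1 := mul_conj_of_mem_unit_sphere hz
  have h2 := sub_ofReal_ne_zero_of_mem_unit_sphere hr hr1 hz
  have h3 := one_sub_mul_ne_zero_of_norm_le_one hr hr1 (mem_sphere_zero_iff_norm.1 hz).le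
  have h0 : z ≠ 0 := by rintro rfl; simp at h1
  have h4 : ((‖1 - (r : ℂ) * z‖ ^ 2 : ℝ) : ℂ) = (1 - r * z) * (z - r) / z := by
    rw [← Complex.normSq_eq_norm_sq, ← Complex.mul_conj]
    simp only [map_sub, map_one, map_mul, Complex.conj_ofReal]
    field_simp
    linear_combination (-(r : ℂ)) * h1
  rw [h4]
  field_simp

/-- The difference of the Cauchy kernels at `r` and `s`, conjugated on the unit circle. -/
def cauchyDiffKernel (r s : ℝ) (z : ℂ) : ℂ :=
  z * ((r : ℂ) - s) * ((1 - (r : ℂ) * z)⁻¹ * (1 - (s : ℂ) * z)⁻¹)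

lemma continuousOn_cauchyDiffKernel {r s : ℝ} (hr : 0 ≤ r) (hr1 : r < 1) (hs : 0 ≤ s)
    (hs1 : s < 1) : ContinuousOn (cauchyDiffKernel r s) (sphere 0 1) := by
  have h1 := (diffContOnCl_inv_one_sub_mul hr hr1).continuousOn_unit_sphere
  have h2 := (diffContOnCl_inv_one_sub_mul hs hs1).continuousOn_unit_sphere
  unfold cauchyDiffKernel
  fun_prop

lemma DiffContOnCl.circleAverage_cauchyDiffKernel_mul {f : ℂ → ℂ}
    (hf : DiffContOnCl ℂ f (ball 0 1)) {r s : ℝ} (hr : 0 ≤ r) (hr1 : r < 1) (hs : 0 ≤ s)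
    (hs1 : s < 1) : Real.circleAverage (fun z => cauchyDiffKernel r s z * f z) 0 1 = 0 := by
  have hid : DiffContOnCl ℂ (fun z : ℂ => z * ((r : ℂ) - s)) (ball 0 1) :=
    Differentiable.diffContOnCl (by fun_prop)
  have h := (((hid.smul ((diffContOnCl_inv_one_sub_mul hr hr1).smul
    (diffContOnCl_inv_one_sub_mul hs hs1))).smul hf))
  rw [show ball (0 : ℂ) 1 = ball 0 |1| by simp] at h
  have h' := h.circleAverage
  simpa [cauchyDiffKernel] using h'

lemma DiffContOnCl.circleAverage_cauchyDiffKernel_mul_conj {f : ℂ → ℂ}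
    (hf : DiffContOnCl ℂ f (ball 0 1)) {r s : ℝ} (hr : 0 ≤ r) (hr1 : r < 1) (hs : 0 ≤ s)
    (hs1 : s < 1) :
    Real.circleAverage (fun z => cauchyDiffKernel r s z * (starRingEnd ℂ) (f z)) 0 1
      = (starRingEnd ℂ) (f r - f s) := by
  have hc := hf.continuousOn_unit_sphere
  have hint : ∀ t : ℝ, 0 ≤ t → t < 1 → CircleIntegrable (fun z => z / (z - t) * f z) 0 1 := by
    intro t ht ht1
    refine ContinuousOn.circleIntegrable zero_le_one (ContinuousOn.mul (ContinuousOn.div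
      continuousOn_id (by fun_prop) fun z hz => sub_ofReal_ne_zero_of_mem_unit_sphere ht ht1 hz) hc)
  rw [← hf.circleAverage_unit_smul_div hr hr1, ← hf.circleAverage_unit_smul_div hs hs1,
    ← Real.circleAverage_fun_sub (hint r hr hr1) (hint s hs hs1)]
  have hcomm := Complex.conjCLE.toContinuousLinearMap.circleAverage_comp_comm
    ((hint r hr hr1).sub (hint s hs hs1))
  refine Eq.trans (Real.circleAverage_congr_sphere fun z hz => ?_) hcomm
  rw [abs_one] at hz
  have h1 := mul_conj_of_mem_unit_sphere hz
  have h2 := one_sub_mul_ne_zero_of_norm_le_one hr hr1 (mem_sphere_zero_iff_norm.1 hz).le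
  have h3 := one_sub_mul_ne_zero_of_norm_le_one hs hs1 (mem_sphere_zero_iff_norm.1 hz).le
  have h0 : z ≠ 0 := by rintro rfl; simp at h1
  have h4 : (starRingEnd ℂ) z = z⁻¹ := eq_inv_of_mul_eq_one_right h1
  have e : ∀ t : ℝ, z⁻¹ / (z⁻¹ - t) = (1 - (t : ℂ) * z)⁻¹ := fun t => by
    rw [show z⁻¹ - (t : ℂ) = z⁻¹ * (1 - t * z) by field_simp, div_mul_cancel_left₀ (inv_ne_zero h0)]
  have e2 : z * ((r : ℂ) - s) * ((1 - (r : ℂ) * z)⁻¹ * (1 - (s : ℂ) * z)⁻¹)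
      = (1 - (r : ℂ) * z)⁻¹ - (1 - (s : ℂ) * z)⁻¹ := by
    rw [inv_sub_inv h2 h3]
    field_simp
    ring
  simp [cauchyDiffKernel, h4, e, e2, sub_mul]

lemma norm_circleAverage_le_of_norm_le {E : Type*} [NormedAddCommGroup E] [NormedSpace ℝ E]
    {g : ℂ → E} {B : ℂ → ℝ} {c : ℂ} {R : ℝ} (hB : CircleIntegrable B c R)
    (h : ∀ z ∈ sphere c |R|, ‖g z‖ ≤ B z) :
    ‖Real.circleAverage g c R‖ ≤ Real.circleAverage B c R := by
  rw [Real.circleAverage_def, Real.circleAverage_def, norm_smul, smul_eq_mul,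
    Real.norm_of_nonneg (by positivity)]
  gcongr
  refine intervalIntegral.norm_integral_le_of_norm_le (by positivity)
    (Filter.Eventually.of_forall fun t _ => h _ (circleMap_mem_sphere' _ _ _)) hB

lemma circleAverage_sq_le {g : ℂ → ℝ} (hg : ContinuousOn g (sphere 0 1)) :
    (Real.circleAverage g 0 1) ^ 2 ≤ Real.circleAverage (fun z => g z ^ 2) 0 1 := by
  set A := Real.circleAverage g 0 1 with hA
  have h1 : CircleIntegrable (fun z => g z ^ 2) 0 1 := (hg.pow 2).circleIntegrable zero_le_one
  have h2 : CircleIntegrable (fun z => 2 * A * g z) 0 1 :=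
    (continuousOn_const.mul hg).circleIntegrable zero_le_one
  have h3 := Real.circleAverage_mono h2 (h1.add (circleIntegrable_const (A ^ 2) 0 1))
    (fun z _ => by simp only [Pi.add_apply]; nlinarith [sq_nonneg (g z - A)])
  rw [Real.circleAverage_add h1 (circleIntegrable_const _ _ _), Real.circleAverage_const] at h3
  have h4 : Real.circleAverage (fun z => 2 * A * g z) 0 1 = 2 * A * A := by
    simpa [smul_eq_mul] using Real.circleAverage_fun_smul (a := 2 * A) (f := g) (c := 0) (R := 1)
  nlinarith

lemma norm_cauchyDiffKernel_mul_le {r s : ℝ} (hr : 0 ≤ r) (hrs : r ≤ s) (hs1 : s < 1) {z : ℂ}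
    (hz : z ∈ sphere (0 : ℂ) 1) :
    ‖cauchyDiffKernel r s z‖ * ‖z - 1‖ ≤ 2 * (1 - r) * ‖1 - (r : ℂ) * z‖⁻¹ := by
  have hz1 := mem_sphere_zero_iff_norm.1 hz
  have h3 : 0 < ‖1 - (s : ℂ) * z‖ :=
    norm_pos_iff.2 (one_sub_mul_ne_zero_of_norm_le_one (hr.trans hrs) hs1 hz1.le)
  have hs : 1 - s ≤ ‖1 - (s : ℂ) * z‖ := by
    have := norm_sub_norm_le (1 : ℂ) ((s : ℂ) * z)
    rwa [norm_mul, hz1, Complex.norm_real, Real.norm_of_nonneg (hr.trans hrs), norm_one,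
      mul_one] at this
  have h4 : ‖z - 1‖ ≤ 2 * ‖1 - (s : ℂ) * z‖ := by
    have e : z - 1 = ((1 - s : ℝ) : ℂ) * z - (1 - (s : ℂ) * z) := by push_cast; ring
    have := norm_sub_le (((1 - s : ℝ) : ℂ) * z) (1 - (s : ℂ) * z)
    rw [← e, norm_mul, hz1, Complex.norm_real, Real.norm_of_nonneg (by linarith)] at this
    linarith
  have h5 : ‖(r : ℂ) - s‖ ≤ 1 - r := by
    rw [← Complex.ofReal_sub, Complex.norm_real, Real.norm_of_nonpos (by linarith)]
    linarith
  rw [cauchyDiffKernel, norm_mul, norm_mul, norm_mul, norm_inv, norm_inv, hz1, one_mul]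
  calc ‖(r : ℂ) - s‖ * (‖1 - (r : ℂ) * z‖⁻¹ * ‖1 - (s : ℂ) * z‖⁻¹) * ‖z - 1‖
      ≤ (1 - r) * (‖1 - (r : ℂ) * z‖⁻¹ * ‖1 - (s : ℂ) * z‖⁻¹) * (2 * ‖1 - (s : ℂ) * z‖) := by
        have : 0 ≤ 1 - r := by linarith
        gcongr
    _ = 2 * (1 - r) * ‖1 - (r : ℂ) * z‖⁻¹ * (‖1 - (s : ℂ) * z‖⁻¹ * ‖1 - (s : ℂ) * z‖) := by ring
    _ = 2 * (1 - r) * ‖1 - (r : ℂ) * z‖⁻¹ := by rw [inv_mul_cancel₀ h3.ne', mul_one]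

lemma DiffContOnCl.euclidean_apply {n : ℕ} {a : ℂ → EuclideanSpace ℂ (Fin n)} {s : Set ℂ}
    (ha : DiffContOnCl ℂ a s) (j : Fin n) : DiffContOnCl ℂ (fun z => a z j) s :=
  (EuclideanSpace.proj j : EuclideanSpace ℂ (Fin n) →L[ℂ] ℂ).differentiable.comp_diffContOnCl ha

lemma DiffContOnCl.tendsto_ofReal_one {E : Type*} [NormedAddCommGroup E] [NormedSpace ℂ E]
    {f : ℂ → E} (hf : DiffContOnCl ℂ f (ball 0 1)) :
    Filter.Tendsto (fun r : ℝ => f r) (nhdsWithin 1 (Ico 0 1)) (nhds (f 1)) := by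
  have h := hf.continuousOn
  rw [closure_ball _ one_ne_zero] at h
  have h1 := h 1 (by simp)
  refine h1.tendsto.comp (tendsto_nhdsWithin_iff.2 ⟨?_, ?_⟩)
  · exact (Complex.continuous_ofReal.tendsto' 1 1 (by simp)).mono_left nhdsWithin_le_nhds
  · filter_upwards [self_mem_nhdsWithin] with r hr
    simp [abs_of_nonneg hr.1, hr.2.le]

section RadialEstimates

variable {n : ℕ} {a b : ℂ → EuclideanSpace ℂ (Fin n)}

lemma continuousOn_norm_mul_inv_norm_one_sub_mul (ha : DiffContOnCl ℂ a (ball 0 1)) {r : ℝ}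
    (hr : 0 ≤ r) (hr1 : r < 1) :
    ContinuousOn (fun z => ‖a z‖ * ‖1 - (r : ℂ) * z‖⁻¹) (sphere 0 1) := by
  refine ha.continuousOn_unit_sphere.norm.mul (ContinuousOn.inv₀ (by fun_prop) fun z hz => ?_)
  exact norm_ne_zero_iff.2
    (one_sub_mul_ne_zero_of_norm_le_one hr hr1 (mem_sphere_zero_iff_norm.1 hz).le)

lemma mul_circleAverage_sq_le_of_re_sum_mul (ha : DiffContOnCl ℂ a (ball 0 1))
    (hb : DiffContOnCl ℂ b (ball 0 1)) {c : ℝ}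
    (h : ∀ z ∈ sphere (0 : ℂ) 1, c * ‖a z‖ ^ 2 ≤ (∑ j, a z j * b z j).re)
    {r : ℝ} (hr : 0 ≤ r) (hr1 : r < 1) :
    c * Real.circleAverage (fun z => (‖a z‖ * ‖1 - (r : ℂ) * z‖⁻¹) ^ 2) 0 1
      ≤ ‖∑ j, a r j * b r j‖ / (1 - r ^ 2) := by
  have hf : DiffContOnCl ℂ (fun z => ∑ j, a z j * b z j) (ball 0 1) := by
    refine ⟨DifferentiableOn.fun_sum fun j _ => ?_, continuousOn_finsetSum _ fun j _ => ?_⟩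
    · exact (ha.euclidean_apply j).differentiableOn.mul (hb.euclidean_apply j).differentiableOn
    · exact (ha.euclidean_apply j).continuousOn.mul (hb.euclidean_apply j).continuousOn
  have hP := hf.circleAverage_div_norm_sq hr hr1
  have hcont : ContinuousOn (fun z => (∑ j, a z j * b z j) /
      ((‖1 - (r : ℂ) * z‖ ^ 2 : ℝ) : ℂ)) (sphere 0 1) := by
    refine hf.continuousOn_unit_sphere.div (by fun_prop) fun z hz => ?_
    have := one_sub_mul_ne_zero_of_norm_le_one hr hr1 (mem_sphere_zero_iff_norm.1 hz).le
    exact_mod_cast pow_ne_zero 2 (norm_ne_zero_iff.2 this)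
  have hre := Complex.reCLM.circleAverage_comp_comm (hcont.circleIntegrable zero_le_one)
  have hmono : Real.circleAverage (fun z => c * (‖a z‖ * ‖1 - (r : ℂ) * z‖⁻¹) ^ 2) 0 1 ≤
      Real.circleAverage (Complex.reCLM ∘ fun z => (∑ j, a z j * b z j) /
      ((‖1 - (r : ℂ) * z‖ ^ 2 : ℝ) : ℂ)) 0 1 := by
    refine Real.circleAverage_mono (ContinuousOn.circleIntegrable zero_le_one
      (((continuousOn_norm_mul_inv_norm_one_sub_mul ha hr hr1).pow 2).const_mul c))
      ((Complex.reCLM.continuous.comp_continuousOn hcont).circleIntegrable zero_le_one)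
      fun z hz => ?_
    rw [abs_one] at hz
    simp only [Function.comp_apply, Complex.reCLM_apply, Complex.div_ofReal_re]
    rw [mul_pow, inv_pow, ← mul_assoc, div_eq_mul_inv]
    exact mul_le_mul_of_nonneg_right (h z hz) (by positivity)
  have hsm : Real.circleAverage (fun z => c * (‖a z‖ * ‖1 - (r : ℂ) * z‖⁻¹) ^ 2) 0 1 =
      c * Real.circleAverage (fun z => (‖a z‖ * ‖1 - (r : ℂ) * z‖⁻¹) ^ 2) 0 1 :=
    Real.circleAverage_fun_smul (a := c) (f := fun z => (‖a z‖ * ‖1 - (r : ℂ) * z‖⁻¹) ^ 2)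
  rw [← hsm]
  refine hmono.trans ?_
  rw [hre, hP, Complex.reCLM_apply]
  refine (Complex.re_le_norm _).trans (le_of_eq ?_)
  rw [norm_div, show (1 : ℂ) - (r : ℂ) ^ 2 = ((1 - r ^ 2 : ℝ) : ℂ) by push_cast; rfl,
    Complex.norm_real, Real.norm_of_nonneg (by nlinarith)]

lemma norm_apply_ofReal_le_of_frozen (ha : DiffContOnCl ℂ a (ball 0 1))
    (hb : DiffContOnCl ℂ b (ball 0 1)) (ha1 : a 1 = 0)
    (T : EuclideanSpace ℂ (Fin n) →L[ℂ] EuclideanSpace ℂ (Fin n)) {M : ℝ}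
    (h : ∀ z ∈ sphere (0 : ℂ) 1, ∀ j,
      ‖(starRingEnd ℂ) (a z j) - (b z - T (a z)) j‖ ≤ M * ‖z - 1‖ * ‖a z‖)
    (hM : 0 ≤ M) {r : ℝ} (hr : 0 ≤ r) (hr1 : r < 1) (j : Fin n) :
    ‖a r j‖ ≤ 2 * M * (1 - r) *
      Real.circleAverage (fun z => ‖a z‖ * ‖1 - (r : ℂ) * z‖⁻¹) 0 1 := by
  have hh : DiffContOnCl ℂ (fun z => (b z - T (a z)) j) (ball 0 1) :=
    (hb.sub (T.differentiable.comp_diffContOnCl ha)).euclidean_apply j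
  have haj := ha.euclidean_apply j
  have hc := continuousOn_norm_mul_inv_norm_one_sub_mul ha hr hr1
  have key : ∀ s : ℝ, r ≤ s → s < 1 → ‖a r j - a s j‖ ≤ 2 * M * (1 - r) *
      Real.circleAverage (fun z => ‖a z‖ * ‖1 - (r : ℂ) * z‖⁻¹) 0 1 := by
    intro s hrs hs1
    have hs := hr.trans hrs
    have hk := continuousOn_cauchyDiffKernel hr hr1 hs hs1
    have e1 := haj.circleAverage_cauchyDiffKernel_mul_conj hr hr1 hs hs1
    have e2 := hh.circleAverage_cauchyDiffKernel_mul hr hr1 hs hs1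
    have e3 := Real.circleAverage_fun_sub (c := 0) (R := 1)
      ((hk.mul (Complex.continuous_conj.comp_continuousOn
        haj.continuousOn_unit_sphere)).circleIntegrable zero_le_one)
      ((hk.mul hh.continuousOn_unit_sphere).circleIntegrable zero_le_one)
    have e4 := e3.trans (congrArg₂ (· - ·) e1 e2)
    simp only [Pi.mul_apply, Function.comp_apply, sub_zero] at e4
    rw [← RCLike.norm_conj, ← e4,
      ← smul_eq_mul (2 * M * (1 - r)), ← Real.circleAverage_fun_smul]
    refine norm_circleAverage_le_of_norm_le
      ((hc.const_smul (2 * M * (1 - r))).circleIntegrable zero_le_one) fun z hz => ?_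
    rw [abs_one] at hz
    rw [← mul_sub, norm_mul, smul_eq_mul]
    calc _ ≤ ‖cauchyDiffKernel r s z‖ * (M * ‖z - 1‖ * ‖a z‖) := by gcongr; exact h z hz j
      _ = M * ‖a z‖ * (‖cauchyDiffKernel r s z‖ * ‖z - 1‖) := by ring
      _ ≤ M * ‖a z‖ * (2 * (1 - r) * ‖1 - (r : ℂ) * z‖⁻¹) := by
        exact mul_le_mul_of_nonneg_left (norm_cauchyDiffKernel_mul_le hr hrs hs1 hz)
          (by positivity)
      _ = _ := by ring
  have ht : Filter.Tendsto (fun s : ℝ => ‖a r j - a s j‖) (nhdsWithin 1 (Ico 0 1))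
      (nhds ‖a r j‖) := by
    have := (haj.tendsto_ofReal_one.const_sub (a r j)).norm
    simpa [ha1] using this
  have : (nhdsWithin (1 : ℝ) (Ico 0 1)).NeBot := by
    rw [nhdsWithin_Ico_eq_nhdsLT zero_lt_one]; infer_instance
  refine le_of_tendsto ht ?_
  have h1 : ∀ᶠ s : ℝ in nhdsWithin 1 (Ico 0 1), r < s :=
    nhdsWithin_le_nhds (lt_mem_nhds hr1)
  filter_upwards [h1, self_mem_nhdsWithin] with s hs hs'
  exact key s hs.le hs'.2

theorem eq_zero_on_ball_of_frozen_of_coercive (ha : DiffContOnCl ℂ a (ball 0 1))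
    (hb : DiffContOnCl ℂ b (ball 0 1)) (ha1 : a 1 = 0) (hb1 : b 1 = 0)
    (T : EuclideanSpace ℂ (Fin n) →L[ℂ] EuclideanSpace ℂ (Fin n)) {M c : ℝ} (hM : 0 ≤ M)
    (hc : 0 < c)
    (hfrozen : ∀ z ∈ sphere (0 : ℂ) 1, ∀ j,
      ‖(starRingEnd ℂ) (a z j) - (b z - T (a z)) j‖ ≤ M * ‖z - 1‖ * ‖a z‖)
    (hcoer : ∀ z ∈ sphere (0 : ℂ) 1, c * ‖a z‖ ^ 2 ≤ (∑ j, a z j * b z j).re) :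
    ∀ w ∈ ball (0 : ℂ) 1, a w = 0 := by
  have hint : CircleIntegrable (fun z => ‖a z‖) 0 1 :=
    ha.continuousOn_unit_sphere.norm.circleIntegrable zero_le_one
  have bound : ∀ r : ℝ, 0 ≤ r → r < 1 →
      c * ((1 / 2) * Real.circleAverage (fun z => ‖a z‖) 0 1) ≤ 2 * M * ∑ j, ‖b r j‖ := by
    intro r hr hr1
    have hcont := continuousOn_norm_mul_inv_norm_one_sub_mul ha hr hr1
    set A := Real.circleAverage (fun z => ‖a z‖ * ‖1 - (r : ℂ) * z‖⁻¹) 0 1 with hA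
    have hA0 : 0 ≤ A := Real.circleAverage_nonneg_of_nonneg fun z _ => by positivity
    have h1 := mul_circleAverage_sq_le_of_re_sum_mul ha hb hcoer hr hr1
    have h2 := circleAverage_sq_le hcont
    have h3 : ‖∑ j, a r j * b r j‖ ≤ 2 * M * (1 - r) * A * ∑ j, ‖b r j‖ := by
      rw [Finset.mul_sum]
      refine norm_sum_le_of_le _ fun j _ => ?_
      rw [norm_mul]
      gcongr
      exact norm_apply_ofReal_le_of_frozen ha hb ha1 T hfrozen hM hr hr1 j
    have h4 : (1 / 2) * Real.circleAverage (fun z => ‖a z‖) 0 1 ≤ A := by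
      rw [← smul_eq_mul, ← Real.circleAverage_fun_smul]
      refine Real.circleAverage_mono (hint.const_smul (a := (1 / 2 : ℝ)))
        (hcont.circleIntegrable zero_le_one) fun z hz => ?_
      rw [abs_one] at hz
      have hz1 := mem_sphere_zero_iff_norm.1 hz
      have h5 : ‖1 - (r : ℂ) * z‖ ≤ 2 := by
        refine (norm_sub_le _ _).trans ?_
        rw [norm_mul, hz1, Complex.norm_real, Real.norm_of_nonneg hr, norm_one]
        linarith
      have h6 := norm_pos_iff.2 (one_sub_mul_ne_zero_of_norm_le_one hr hr1 hz1.le)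
      rw [smul_eq_mul, mul_comm, one_div]
      gcongr
    refine (mul_le_mul_of_nonneg_left h4 hc.le).trans ?_
    rcases hA0.eq_or_lt with h0 | h0
    · rw [← h0, mul_zero]; positivity
    have hS : 0 ≤ ∑ j, ‖b r j‖ := by positivity
    have h7 : ‖∑ j, a r j * b r j‖ / (1 - r ^ 2) ≤ 2 * M * A * ∑ j, ‖b r j‖ := by
      rw [div_le_iff₀ (by nlinarith)]
      have : 0 ≤ 2 * M * A * (∑ j, ‖b r j‖) * (r * (1 - r)) := by
        have : 0 ≤ 1 - r := by linarith
        positivity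
      nlinarith
    refine le_of_mul_le_mul_right ?_ h0
    nlinarith [mul_le_mul_of_nonneg_left h2 hc.le]
  have hK : Real.circleAverage (fun z => ‖a z‖) 0 1 ≤ 0 := by
    have ht : Filter.Tendsto (fun r : ℝ => 2 * M * ∑ j, ‖b r j‖) (nhdsWithin 1 (Ico 0 1))
        (nhds 0) := by
      have := (tendsto_finsetSum Finset.univ fun j _ =>
        (hb.euclidean_apply j).tendsto_ofReal_one.norm).const_mul (2 * M)
      simpa [hb1] using this
    have : (nhdsWithin (1 : ℝ) (Ico 0 1)).NeBot := by
      rw [nhdsWithin_Ico_eq_nhdsLT zero_lt_one]; infer_instance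
    have h := ge_of_tendsto ht (by
      filter_upwards [self_mem_nhdsWithin] with r hr using bound r hr.1 hr.2)
    nlinarith
  intro w hw
  have hw1 : ‖w‖ < 1 := mem_ball_zero_iff.1 hw
  have hrep := DiffContOnCl.circleAverage_smul_div (f := a) (c := 0) (R := 1) (w := w)
    (by simpa using ha) (by simpa using hw)
  have hle := norm_circleAverage_le_of_norm_le (g := fun z => ((z - 0) / (z - w)) • a z)
    (B := fun z => (1 - ‖w‖)⁻¹ • ‖a z‖) (c := 0) (R := 1) (hint.const_smul (a := (1 - ‖w‖)⁻¹))
    (fun z hz => by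
      rw [abs_one] at hz
      have hz1 := mem_sphere_zero_iff_norm.1 hz
      rw [norm_smul, norm_div, sub_zero, hz1, one_div, smul_eq_mul]
      have : 0 < 1 - ‖w‖ := by linarith
      gcongr
      have := norm_sub_norm_le z w
      linarith)
  rw [hrep, Real.circleAverage_fun_smul, smul_eq_mul] at hle
  have : (0 : ℝ) ≤ (1 - ‖w‖)⁻¹ := inv_nonneg.2 (by linarith)
  exact norm_le_zero_iff.1 (hle.trans (mul_nonpos_of_nonneg_of_nonpos this hK))

end RadialEstimates

lemma OHolder.hasDerivWithinAt {E : Type*} [NormedAddCommGroup E] [NormedSpace ℂ E] {α : ℝ}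
    {g : ℂ → E} (hg : OHolder 1 α g) {z : ℂ} (hz : z ∈ cDisc) :
    HasDerivWithinAt g (derivWithin g cDisc z) cDisc z := by
  have hcd : ContDiffOn ℝ 1 g cDisc := by exact_mod_cast hg.2.2.1
  have hu : UniqueDiffOn ℝ cDisc := uniqueDiffOn_convex (convex_closedBall _ _)
    (by rw [cDisc, interior_closedBall _ one_ne_zero]; exact ⟨0, by simp⟩)
  have hcont := hcd.continuousOn_fderivWithin hu le_rfl
  have heq : EqOn (fun w => fderivWithin ℝ g cDisc w Complex.I)
      (fun w => Complex.I • fderivWithin ℝ g cDisc w 1) cDisc := by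
    refine EqOn.of_subset_closure (s := uDisc) (fun w hw => ?_) (by fun_prop) (by fun_prop)
      ball_subset_closedBall (closure_ball _ one_ne_zero).ge
    have h1 := ((hg.1 w hw).differentiableAt (isOpen_ball.mem_nhds hw)).hasFDerivAt
    have h2 := (h1.restrictScalars ℝ).hasFDerivWithinAt (s := cDisc)
    simp only [h2.fderivWithin (hu w (ball_subset_closedBall hw)),
      ContinuousLinearMap.coe_restrictScalars']
    rw [← map_smul, smul_eq_mul, mul_one]
  have hD := (hcd.differentiableOn one_ne_zero z hz).hasFDerivWithinAt
  have hlin : (ContinuousLinearMap.toSpanSingleton ℂ (fderivWithin ℝ g cDisc z 1)).restrictScalars ℝ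
      = fderivWithin ℝ g cDisc z := by
    ext w
    have hw : w = w.re • (1 : ℂ) + w.im • Complex.I := by
      simp [Complex.re_add_im]
    have h1 : fderivWithin ℝ g cDisc z w = w.re • fderivWithin ℝ g cDisc z 1
        + w.im • (Complex.I • fderivWithin ℝ g cDisc z 1) := by
      conv_lhs => rw [hw]
      rw [map_add, map_smul, map_smul]
      exact congrArg _ (congrArg _ (heq hz))
    rw [h1]
    simp only [ContinuousLinearMap.coe_restrictScalars', ContinuousLinearMap.toSpanSingleton_apply]
    conv_lhs => rw [hw, add_smul]
    simp [mul_smul]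
  exact (HasFDerivWithinAt.of_restrictScalars ℝ hD hlin).differentiableWithinAt.hasDerivWithinAt

lemma diffContOnCl_inv_sub_one_smul {E : Type*} [NormedAddCommGroup E] [NormedSpace ℂ E]
    {g : ℂ → E} (hd : DifferentiableOn ℂ g uDisc) (hc : ContinuousOn g cDisc) (h0 : g 1 = 0)
    (h1 : HasDerivWithinAt g 0 cDisc 1) :
    DiffContOnCl ℂ (fun z => (z - 1)⁻¹ • g z) (ball 0 1) := by
  refine ⟨DifferentiableOn.smul (DifferentiableOn.inv (by fun_prop) fun z hz h => ?_) hd, ?_⟩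
  · rw [sub_eq_zero.1 h] at hz
    simp at hz
  · rw [closure_ball _ one_ne_zero]
    intro z hz
    by_cases hz1 : z = 1
    · subst hz1
      rw [← continuousWithinAt_sdiff_self]
      have := hasDerivWithinAt_iff_tendsto_slope.1 h1
      simpa [ContinuousWithinAt, slope_fun_def, h0, cDisc] using this
    · exact ContinuousWithinAt.smul (ContinuousWithinAt.inv₀ (by fun_prop) (sub_ne_zero.2 hz1))
        (hc z hz)

lemma hasDerivAt_exp_ofReal_mul_I_zero :
    HasDerivAt (fun t : ℝ => Complex.exp ((t : ℂ) * Complex.I)) Complex.I 0 := by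
  have h : HasDerivAt (fun t : ℝ => (t : ℂ) * Complex.I) Complex.I 0 := by
    simpa using (Complex.ofRealCLM.hasDerivAt (x := 0)).mul_const Complex.I
  simpa using h.cexp

lemma HasDerivWithinAt.eq_zero_of_norm_le_on_circle {E F : Type*} [NormedAddCommGroup E]
    [NormedSpace ℂ E] [NormedAddCommGroup F] [NormedSpace ℂ F] {f : ℂ → E} {g : ℂ → F} {g' : F}
    (hf : HasDerivWithinAt f 0 cDisc 1) (hg : HasDerivWithinAt g g' cDisc 1) (hf1 : f 1 = 0)
    (hg1 : g 1 = 0) {C : ℝ} (hle : ∀ z ∈ uCircle, ‖g z‖ ≤ C * ‖f z‖) : g' = 0 := by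
  have hmem : ∀ t : ℝ, Complex.exp ((t : ℂ) * Complex.I) ∈ uCircle := fun t => by
    simp [uCircle, Complex.norm_exp_ofReal_mul_I]
  have hmem' : ∀ t : ℝ, Complex.exp ((t : ℂ) * Complex.I) ∈ cDisc := fun t =>
    sphere_subset_closedBall (hmem t)
  have hf2 : HasDerivAt (fun t : ℝ => f (Complex.exp ((t : ℂ) * Complex.I))) 0 0 := by
    have := HasDerivWithinAt.scomp_hasDerivAt_of_eq (0 : ℝ) hf hasDerivAt_exp_ofReal_mul_I_zero hmem'
      (by simp)
    simpa [Function.comp_def] using this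
  have hg2 : HasDerivAt (fun t : ℝ => g (Complex.exp ((t : ℂ) * Complex.I)))
      (Complex.I • g') 0 :=
    HasDerivWithinAt.scomp_hasDerivAt_of_eq (0 : ℝ) hg hasDerivAt_exp_ofReal_mul_I_zero hmem'
      (by simp)
  have hg3 : HasDerivAt (fun t : ℝ => g (Complex.exp ((t : ℂ) * Complex.I))) 0 0 := by
    rw [hasDerivAt_iff_isLittleO] at hf2 ⊢
    simp only [Complex.ofReal_zero, zero_mul, Complex.exp_zero, hf1, hg1, sub_zero, smul_zero]
      at hf2 ⊢
    exact (Asymptotics.IsBigO.of_bound C (Filter.Eventually.of_forall fun t =>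
      hle _ (hmem t))).trans_isLittleO hf2
  exact (smul_eq_zero.1 (hg2.unique hg3)).resolve_left Complex.I_ne_zero

lemma exp_arg_mul_I_of_mem_uCircle {z : ℂ} (hz : z ∈ uCircle) :
    Complex.exp ((z.arg : ℂ) * Complex.I) = z := by
  have := Complex.norm_mul_exp_arg_mul_I z
  rwa [mem_sphere_zero_iff_norm.1 hz, Complex.ofReal_one, one_mul] at this

lemma abs_arg_le_of_mem_uCircle {z : ℂ} (hz : z ∈ uCircle) :
    |z.arg| ≤ Real.pi / 2 * ‖z - 1‖ := by
  have h1 : ‖z - 1‖ = ‖2 * Real.sin (z.arg / 2)‖ := by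
    rw [← Complex.norm_exp_I_mul_ofReal_sub_one, mul_comm, exp_arg_mul_I_of_mem_uCircle hz]
  have h2 : |z.arg / 2| ≤ Real.pi / 2 := by
    rw [abs_div, abs_two]
    linarith [Complex.abs_arg_le_pi z]
  have h3 := Real.mul_abs_le_abs_sin h2
  rw [h1, norm_mul, Real.norm_eq_abs, Real.norm_eq_abs, abs_two]
  rw [abs_div, abs_two] at h3
  have hpi := Real.pi_pos
  calc |z.arg| = Real.pi * (2 / Real.pi * (|z.arg| / 2)) := by field_simp
    _ ≤ Real.pi * |Real.sin (z.arg / 2)| := by gcongr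
    _ = _ := by ring

lemma CircleCk.contDiff {F : Type*} [NormedAddCommGroup F] [NormedSpace ℝ F] {α : ℝ} {f : ℂ → F}
    (hf : CircleCk 1 α f) :
    ContDiff ℝ 1 (fun t : ℝ => f (Complex.exp ((t : ℂ) * Complex.I))) := by
  rw [← contDiffOn_univ]
  exact_mod_cast hf.1

lemma CircleCk.exists_norm_sub_le {F : Type*} [NormedAddCommGroup F] [NormedSpace ℝ F] {α : ℝ}
    {f : ℂ → F} (hf : CircleCk 1 α f) :
    ∃ M, 0 ≤ M ∧ ∀ z ∈ uCircle, ‖f z - f 1‖ ≤ M * ‖z - 1‖ := by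
  obtain ⟨C, hC⟩ := (isCompact_Icc (a := -Real.pi) (b := Real.pi)).exists_bound_of_continuousOn
    (hf.contDiff.continuous_deriv le_rfl).continuousOn
  have hpi := Real.pi_pos
  have h0 : (0 : ℝ) ∈ Icc (-Real.pi) Real.pi := ⟨by linarith, hpi.le⟩
  have hC0 : 0 ≤ C := (norm_nonneg _).trans (hC 0 h0)
  refine ⟨C * (Real.pi / 2), by positivity, fun z hz => ?_⟩
  have := (convex_Icc (-Real.pi) Real.pi).norm_image_sub_le_of_norm_deriv_le
    (fun x _ => hf.contDiff.differentiable one_ne_zero x) hC h0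
    (abs_le.1 (Complex.abs_arg_le_pi z))
  simp only [exp_arg_mul_I_of_mem_uCircle hz, Complex.ofReal_zero, zero_mul, Complex.exp_zero,
    sub_zero, Real.norm_eq_abs] at this
  rw [mul_assoc]
  exact this.trans (mul_le_mul_of_nonneg_left (abs_arg_le_of_mem_uCircle hz) hC0)

lemma exists_uniform_norm_toEuclideanLin_le {n : ℕ} {α : ℝ} {S : ℂ → Matrix (Fin n) (Fin n) ℂ}
    (hSreg : ∀ i j, CircleCk 1 α (fun ζ => S ζ i j))
    (hSnorm : ∀ ζ ∈ uCircle, ∀ v : EuclideanSpace ℂ (Fin n), v ≠ 0 →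
      ‖Matrix.toEuclideanLin (S ζ) v‖ < ‖v‖) :
    ∃ c : ℝ, 0 < c ∧ ∀ ζ ∈ uCircle, ∀ v : EuclideanSpace ℂ (Fin n),
      ‖Matrix.toEuclideanLin (S ζ) v‖ ≤ (1 - c) * ‖v‖ := by
  have hScont : Continuous fun t : ℝ => S (Complex.exp ((t : ℂ) * Complex.I)) :=
    continuous_matrix fun i j => (hSreg i j).contDiff.continuous
  have hcont : Continuous fun p : ℝ × EuclideanSpace ℂ (Fin n) =>
      1 - ‖Matrix.toEuclideanLin (S (Complex.exp ((p.1 : ℂ) * Complex.I))) p.2‖ := by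
    refine continuous_const.sub (Continuous.norm ?_)
    simp only [Matrix.toLpLin_apply]
    refine (PiLp.continuous_toLp 2 _).comp (Continuous.matrix_mulVec (hScont.comp continuous_fst)
      ((PiLp.continuous_ofLp 2 _).comp continuous_snd))
  obtain ⟨c, hc, hle⟩ := ((isCompact_Icc (a := -Real.pi) (b := Real.pi)).prod
    (isCompact_sphere (0 : EuclideanSpace ℂ (Fin n)) 1)).exists_forall_le' hcont.continuousOn
    (a := 0) (fun p hp => by
      have h1 := mem_sphere_zero_iff_norm.1 hp.2
      have h2 := hSnorm (Complex.exp ((p.1 : ℂ) * Complex.I))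
        (by simp [uCircle, Complex.norm_exp_ofReal_mul_I]) p.2
        (norm_ne_zero_iff.1 (by rw [h1]; exact one_ne_zero))
      linarith)
  refine ⟨c, hc, fun z hz v => ?_⟩
  rcases eq_or_ne v 0 with rfl | hv
  · simp
  have hv' := norm_pos_iff.2 hv
  have h := hle (z.arg, ((‖v‖⁻¹ : ℝ) : ℂ) • v) ⟨abs_le.1 (Complex.abs_arg_le_pi z), by
    simp [norm_smul, hv'.ne']⟩
  simp only [exp_arg_mul_I_of_mem_uCircle hz, map_smul, norm_smul, Complex.norm_real, norm_inv,
    norm_norm] at h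
  have h2 : ‖v‖⁻¹ * ‖Matrix.toEuclideanLin (S z) v‖ ≤ 1 - c := by linarith
  rwa [inv_mul_le_iff₀ hv', mul_comm] at h2

@[simp] lemma conjVecE_apply {n : ℕ} (v : EuclideanSpace ℂ (Fin n)) (j : Fin n) :
    conjVecE v j = (starRingEnd ℂ) (v j) := rfl

@[simp] lemma norm_conjVecE {n : ℕ} (v : EuclideanSpace ℂ (Fin n)) : ‖conjVecE v‖ = ‖v‖ := by
  simp [EuclideanSpace.norm_eq]

lemma norm_sum_mul_le {n : ℕ} (v w : EuclideanSpace ℂ (Fin n)) :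
    ‖∑ j, v j * w j‖ ≤ ‖v‖ * ‖w‖ := by
  have h := norm_inner_le_norm (𝕜 := ℂ) (conjVecE v) w
  rw [norm_conjVecE, PiLp.inner_apply] at h
  simpa [mul_comm] using h

lemma sum_mul_conj_eq_norm_sq {n : ℕ} (v : EuclideanSpace ℂ (Fin n)) :
    ∑ j, v j * (starRingEnd ℂ) (v j) = ((‖v‖ ^ 2 : ℝ) : ℂ) := by
  rw [EuclideanSpace.norm_sq_eq]
  push_cast
  exact Finset.sum_congr rfl fun j _ => Complex.mul_conj' _

lemma norm_toEuclideanLin_apply_le {n : ℕ} (A : Matrix (Fin n) (Fin n) ℂ)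
    (v : EuclideanSpace ℂ (Fin n)) (j : Fin n) :
    ‖Matrix.toEuclideanLin A v j‖ ≤ (∑ i, ∑ k, ‖A i k‖) * ‖v‖ := by
  have h1 : ‖Matrix.toEuclideanLin A v j‖ ≤ ∑ k, ‖A j k‖ * ‖v‖ := by
    simp only [Matrix.toLpLin_apply, Matrix.mulVec, dotProduct]
    refine norm_sum_le_of_le _ fun k _ => ?_
    rw [norm_mul]
    gcongr
    exact PiLp.norm_apply_le v k
  rw [← Finset.sum_mul] at h1
  refine h1.trans (mul_le_mul_of_nonneg_right ?_ (norm_nonneg v))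
  exact Finset.single_le_sum (f := fun i => ∑ k, ‖A i k‖)
    (fun i _ => Finset.sum_nonneg fun k _ => norm_nonneg _) (Finset.mem_univ j)

lemma exists_sum_norm_inv_smul_sub_le {n : ℕ} {α : ℝ} {S : ℂ → Matrix (Fin n) (Fin n) ℂ}
    (hSreg : ∀ i j, CircleCk 1 α (fun ζ => S ζ i j)) :
    ∃ M, 0 ≤ M ∧ ∀ z ∈ uCircle, ∑ i, ∑ k, ‖(z⁻¹ • S z - S 1) i k‖ ≤ M * ‖z - 1‖ := by
  choose M hM0 hM using fun i j => (hSreg i j).exists_norm_sub_le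
  refine ⟨∑ i, ∑ k, (M i k + ‖S 1 i k‖), Finset.sum_nonneg fun i _ => Finset.sum_nonneg fun k _ =>
    add_nonneg (hM0 i k) (norm_nonneg _), fun z hz => ?_⟩
  simp only [Finset.sum_mul]
  refine Finset.sum_le_sum fun i _ => Finset.sum_le_sum fun k _ => ?_
  have hz1 : ‖z‖ = 1 := mem_sphere_zero_iff_norm.1 hz
  have hz0 : z ≠ 0 := norm_ne_zero_iff.1 (by rw [hz1]; exact one_ne_zero)
  have e : (z⁻¹ • S z - S 1) i k = z⁻¹ * (S z i k - S 1 i k) - z⁻¹ * (z - 1) * S 1 i k := by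
    simp only [Matrix.sub_apply, Matrix.smul_apply, smul_eq_mul]
    field_simp
    ring
  rw [e]
  refine (norm_sub_le _ _).trans ?_
  rw [norm_mul, norm_mul, norm_mul, norm_inv, hz1, inv_one, one_mul, one_mul, add_mul,
    mul_comm ‖S 1 i k‖]
  gcongr
  exact hM i k z hz

/-- Uniqueness for the homogeneous 1-jet Riemann–Hilbert problem with `H = Iₙ`. -/
theorem homogeneous_RH_one_jet_uniqueness
    (n : ℕ) (hn : 1 ≤ n) (α : ℝ) (hα0 : 0 < α) (hα1 : α < 1)
    (S : ℂ → Matrix (Fin n) (Fin n) ℂ)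
    (hSreg : ∀ i j, CircleCk 1 α (fun ζ => S ζ i j))
    (hSymm : ∀ ζ ∈ uCircle, (S ζ).IsSymm)
    (hSnorm : ∀ ζ ∈ uCircle, ∀ v : EuclideanSpace ℂ (Fin n), v ≠ 0 →
      ‖Matrix.toEuclideanLin (S ζ) v‖ < ‖v‖)
    (φ : ℂ → EuclideanSpace ℂ (Fin n)) (hφ : OHolder 1 α φ)
    (h1 : φ 1 = 0) (h1' : derivWithin φ cDisc 1 = 0)
    (hext : ∃ G : ℂ → EuclideanSpace ℂ (Fin n), OHolder 1 α G ∧ ∀ ζ ∈ uCircle,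
      G ζ = conjVecE ((ζ⁻¹ : ℂ) • φ ζ) + Matrix.toEuclideanLin (S ζ) ((ζ⁻¹ : ℂ) • φ ζ)) :
    EqOn φ 0 cDisc := by
  obtain ⟨G, hG, hGeq⟩ := hext
  obtain ⟨c, hc, hSc⟩ := exists_uniform_norm_toEuclideanLin_le hSreg hSnorm
  obtain ⟨M, hM, hSM⟩ := exists_sum_norm_inv_smul_sub_le hSreg
  have hone : (1 : ℂ) ∈ cDisc := by simp [cDisc]
  have hone' : (1 : ℂ) ∈ uCircle := by simp [uCircle]
  have hG1 : G 1 = 0 := by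
    rw [hGeq 1 hone', h1, smul_zero, map_zero, add_zero, ← norm_eq_zero, norm_conjVecE, norm_zero]
  have hφd := hφ.hasDerivWithinAt hone
  rw [h1'] at hφd
  have hGd := hG.hasDerivWithinAt hone
  rw [hφd.eq_zero_of_norm_le_on_circle hGd h1 hG1 (C := 2) fun z hz => ?_] at hGd
  swap
  · have hz1 : ‖z‖ = 1 := mem_sphere_zero_iff_norm.1 hz
    have hn1 : ‖z⁻¹ • φ z‖ = ‖φ z‖ := by rw [norm_smul, norm_inv, hz1, inv_one, one_mul]
    have h2 := hSc z hz (z⁻¹ • φ z)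
    rw [hGeq z hz]
    refine (norm_add_le _ _).trans ?_
    rw [norm_conjVecE]
    rw [hn1] at h2 ⊢
    nlinarith [norm_nonneg (φ z)]
  have ha := diffContOnCl_inv_sub_one_smul hφ.1 hφ.2.1 h1 hφd
  have hb := (diffContOnCl_inv_sub_one_smul hG.1 hG.2.1 hG1 hGd).neg
  set a : ℂ → EuclideanSpace ℂ (Fin n) := fun z => (z - 1)⁻¹ • φ z with ha_def
  set b : ℂ → EuclideanSpace ℂ (Fin n) := -fun z => (z - 1)⁻¹ • G z with hb_def
  have hbdry : ∀ z ∈ uCircle, ∀ j, b z j =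
      (starRingEnd ℂ) (a z j) - z⁻¹ * Matrix.toEuclideanLin (S z) (a z) j := by
    intro z hz j
    have hz1 := mul_conj_of_mem_unit_sphere hz
    have hz0 : z ≠ 0 := by rintro rfl; simp at hz1
    have hconj : (starRingEnd ℂ) z = z⁻¹ := eq_inv_of_mul_eq_one_right hz1
    rcases eq_or_ne z 1 with rfl | hne
    · simp [ha_def, hb_def]
    have hne' : z - 1 ≠ 0 := sub_ne_zero.2 hne
    have hne2 : z⁻¹ - 1 ≠ 0 := sub_ne_zero.2 (by simpa using hne)
    have e : (z⁻¹ - 1)⁻¹ = -((z - 1)⁻¹ * z) := by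
      rw [inv_eq_iff_eq_inv, ← mul_left_inj' hz0]
      field_simp
      ring
    simp only [ha_def, hb_def, Pi.neg_apply, PiLp.neg_apply, PiLp.smul_apply, hGeq z hz,
      PiLp.add_apply, conjVecE_apply, map_smul, smul_eq_mul, map_mul, map_inv₀, map_sub, map_one,
      hconj, inv_inv, e]
    ring
  have hzero := eq_zero_on_ball_of_frozen_of_coercive ha hb (by simp [ha_def]) (by simp [hb_def])
    (-(Matrix.toEuclideanLin (S 1)).toContinuousLinearMap) hM hc (fun z hz j => ?_)
    (fun z hz => ?_)
  · have hball : EqOn φ 0 uDisc := fun z hz => by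
      have hz1 : z - 1 ≠ 0 := by
        intro h
        rw [sub_eq_zero.1 h] at hz
        simp [uDisc] at hz
      exact (smul_eq_zero.1 (hzero z hz)).resolve_left (inv_ne_zero hz1)
    exact hball.of_subset_closure hφ.2.1 continuousOn_const ball_subset_closedBall
      (closure_ball _ one_ne_zero).ge
  · have e : (starRingEnd ℂ) (a z j) - (b z -
        (-(Matrix.toEuclideanLin (S 1)).toContinuousLinearMap) (a z)) j =
        Matrix.toEuclideanLin (z⁻¹ • S z - S 1) (a z) j := by
      simp only [PiLp.sub_apply, hbdry z hz j, map_sub, map_smul, LinearMap.sub_apply,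
        LinearMap.smul_apply, PiLp.smul_apply, smul_eq_mul, neg_apply,
        PiLp.neg_apply, LinearMap.coe_toContinuousLinearMap']
      ring
    rw [e]
    refine (norm_toEuclideanLin_apply_le _ _ _).trans ?_
    gcongr
    exact hSM z hz
  · have hz1 : ‖z‖ = 1 := mem_sphere_zero_iff_norm.1 hz
    have e : ∑ j, a z j * b z j = ((‖a z‖ ^ 2 : ℝ) : ℂ) -
        z⁻¹ * ∑ j, a z j * Matrix.toEuclideanLin (S z) (a z) j := by
      rw [← sum_mul_conj_eq_norm_sq, Finset.mul_sum, ← Finset.sum_sub_distrib]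
      refine Finset.sum_congr rfl fun j _ => ?_
      rw [hbdry z hz j]
      ring
    rw [e, Complex.sub_re, Complex.ofReal_re]
    have h2 := Complex.re_le_norm (z⁻¹ * ∑ j, a z j * Matrix.toEuclideanLin (S z) (a z) j)
    rw [norm_mul, norm_inv, hz1, inv_one, one_mul] at h2
    have h3 := norm_sum_mul_le (a z) (Matrix.toEuclideanLin (S z) (a z))
    have h4 := mul_le_mul_of_nonneg_left (hSc z hz (a z)) (norm_nonneg (a z))
    nlinarith
end
end

section
/- Let f : Δ̄ → ℂ be continuous on Δ̄, holomorphic on Δ, and twice continuously differentiable up to the boundary (f ∈ C²(Δ̄)). Suppose f(1) = 0, f'(1) = 0, and Re(f(ζ)/ζ) = 0 for every ζ ∈ ∂Δ. Then there exists a real constant c such that f(ζ) = i·c·(1 − ζ)² for all ζ ∈ Δ̄. -/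
open Set Metric

noncomputable section

/-- A function continuous on the closed unit disc and holomorphic inside whose real part is
nonpositive on the unit circle has nonpositive real part on the whole disc. -/
theorem re_nonpos_of_re_nonpos_on_uCircle {h : ℂ → ℂ} (hd : DiffContOnCl ℂ h (ball 0 1))
    (hre : ∀ z ∈ uCircle, (h z).re ≤ 0) {z : ℂ} (hz : z ∈ cDisc) : (h z).re ≤ 0 := by
  have hexp : DiffContOnCl ℂ (fun w => Complex.exp (h w)) (ball 0 1) :=
    ⟨hd.differentiableOn.cexp, hd.continuousOn.cexp⟩
  have key := Complex.norm_le_of_forall_mem_frontier_norm_le (C := 1) isBounded_ball hexp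
    (fun w hw => by
      rw [frontier_ball _ one_ne_zero] at hw
      simpa [Complex.norm_exp] using hre w hw)
    (z := z) (by rwa [closure_ball _ one_ne_zero])
  simpa [Complex.norm_exp] using key

/-- A function continuous on the closed unit disc and holomorphic inside whose real part vanishes
on the unit circle is an imaginary constant. -/
theorem exists_eq_I_mul_of_re_eq_zero_on_uCircle {h : ℂ → ℂ}
    (hd : DiffContOnCl ℂ h (ball 0 1)) (hre : ∀ z ∈ uCircle, (h z).re = 0) :
    ∃ b : ℝ, ∀ z ∈ cDisc, h z = Complex.I * b := by
  have hre0 : ∀ z ∈ cDisc, (h z).re = 0 := by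
    intro z hz
    have hneg := re_nonpos_of_re_nonpos_on_uCircle hd.neg (fun w hw => by simp [hre w hw]) hz
    exact le_antisymm (re_nonpos_of_re_nonpos_on_uCircle hd (fun w hw => (hre w hw).le) hz)
      (by simpa using hneg)
  have hball : EqOn h (fun _ => h 0) (ball 0 1) := by
    obtain ⟨c, hc⟩ := (hd.differentiableOn.analyticOnNhd isOpen_ball).eq_const_of_re_eq_const
      (fun z hz => hre0 z (ball_subset_closedBall hz)) isOpen_ball
      ((convex_ball (0 : ℂ) 1).isConnected ⟨0, mem_ball_self one_pos⟩)
    intro z hz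
    rw [hc z hz, hc 0 (mem_ball_self one_pos)]
  refine ⟨(h 0).im, fun z hz => ?_⟩
  have hz' : z ∈ closure (ball (0 : ℂ) 1) := by rwa [closure_ball _ one_ne_zero]
  rw [hball.of_subset_closure hd.continuousOn continuousOn_const subset_closure subset_rfl hz']
  apply Complex.ext <;> simp [hre0 0 (mem_closedBall_self zero_le_one)]

/-- A function continuous on the closed unit disc and holomorphic inside with `Re (f ζ / ζ) = 0`
on the unit circle is a quadratic polynomial `a + i b ζ - conj a ζ²` with `b` real. -/
theorem exists_eq_quadratic_of_re_div_eq_zero {f : ℂ → ℂ}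
    (hfc : ContinuousOn f cDisc) (hfh : DifferentiableOn ℂ f uDisc)
    (hre : ∀ ζ ∈ uCircle, (f ζ / ζ).re = 0) :
    ∃ (a : ℂ) (b : ℝ), ∀ ζ ∈ cDisc,
      f ζ = a + Complex.I * b * ζ - (starRingEnd ℂ) a * ζ ^ 2 := by
  set g : ℂ → ℂ := fun ζ => f ζ + (starRingEnd ℂ) (f 0) * ζ ^ 2 with hg
  have hball : ball (0 : ℂ) 1 ∈ nhds 0 := ball_mem_nhds 0 one_pos
  have hgd : DifferentiableOn ℂ g (ball 0 1) :=
    hfh.add (by fun_prop)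
  have hgc : ContinuousOn g (closedBall 0 1) := hfc.add (by fun_prop)
  have hd : DiffContOnCl ℂ (dslope g 0) (ball 0 1) := by
    refine ⟨(Complex.differentiableOn_dslope hball).2 hgd, ?_⟩
    rw [closure_ball _ one_ne_zero, continuousOn_dslope (closedBall_mem_nhds 0 one_pos)]
    exact ⟨hgc, hgd.differentiableAt hball⟩
  obtain ⟨b, hb⟩ := exists_eq_I_mul_of_re_eq_zero_on_uCircle hd fun z hz => by
    have hz1 : ‖z‖ = 1 := by simpa [uCircle] using hz
    have hz0 : z ≠ 0 := by
      rintro rfl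
      simp at hz1
    have hinv : z⁻¹ = (starRingEnd ℂ) z := Complex.inv_eq_conj hz1
    have heq : dslope g 0 z = f z / z + ((starRingEnd ℂ) (f 0 * z⁻¹) - f 0 * z⁻¹) := by
      rw [dslope_of_ne _ hz0, slope_def_field, map_mul, hinv, Complex.conj_conj, ← hinv]
      simp only [hg]
      field_simp
      ring
    rw [heq, Complex.add_re, hre z hz, Complex.sub_re, Complex.conj_re]
    ring
  refine ⟨f 0, b, fun ζ hζ => ?_⟩
  have h := sub_smul_dslope g 0 ζ
  rw [hb ζ hζ] at h
  simp only [hg, smul_eq_mul, sub_zero] at h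
  linear_combination -h

/-- If `f` is holomorphic on `Δ`, of class `C²` on `Δ̄`, vanishes to second order at `1`,
and `Re(f(ζ)/ζ) = 0` on `∂Δ`, then `f(ζ) = i c (1 - ζ)²` for some real constant `c`. -/
theorem second_order_vanishing_real_part
    (f : ℂ → ℂ)
    (hfc : ContinuousOn f cDisc) (hfh : DifferentiableOn ℂ f uDisc)
    (hf2 : ContDiffOn ℝ 2 f cDisc)
    (h1 : f 1 = 0) (h1' : derivWithin f cDisc 1 = 0)
    (hre : ∀ ζ ∈ uCircle, (f ζ / ζ).re = 0) :
    ∃ c : ℝ, ∀ ζ ∈ cDisc, f ζ = Complex.I * (c : ℂ) * (1 - ζ) ^ 2 := by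
  obtain ⟨a, b, hab⟩ := exists_eq_quadratic_of_re_div_eq_zero hfc hfh hre
  have hmem : (1 : ℂ) ∈ cDisc := by simp [cDisc]
  have hderiv : HasDerivAt (fun ζ : ℂ => a + Complex.I * b * ζ - (starRingEnd ℂ) a * ζ ^ 2)
      (Complex.I * b - (starRingEnd ℂ) a * 2) 1 := by
    have hsub := (((hasDerivAt_id' (1 : ℂ)).const_mul (Complex.I * b)).const_add a).sub
      ((hasDerivAt_pow 2 (1 : ℂ)).const_mul ((starRingEnd ℂ) a))
    exact hsub.congr_deriv (by norm_num)
  have huniq : UniqueDiffWithinAt ℂ cDisc 1 :=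
    uniqueDiffWithinAt_convex_of_isRCLikeNormedField (convex_closedBall (0 : ℂ) 1)
      ⟨0, ball_subset_interior_closedBall (mem_ball_self one_pos)⟩ (subset_closure hmem)
  rw [(hderiv.hasDerivWithinAt.congr hab (hab 1 hmem)).derivWithin huniq] at h1'
  have hre' := congrArg Complex.re h1'
  have him := congrArg Complex.im h1'
  simp at hre' him
  have hb : b = -2 * a.im := by linarith
  have ha : a = Complex.I * a.im := by apply Complex.ext <;> simp [hre']
  refine ⟨a.im, fun ζ hζ => ?_⟩
  have hconj : (starRingEnd ℂ) a = -(Complex.I * a.im) := by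
    apply Complex.ext <;> simp [hre']
  rw [hab ζ hζ, hconj, hb]
  push_cast
  linear_combination ha
end
end
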